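/- Fix δ ∈ (1/2, ∞) and SNR > 0, and let τ* be the unique positive minimizer of F. Define G : (0, ∞) → ℝ by G(u) = √(2/π)·u·e^{−2u²} + (1 − 4u²)·Q(2u). Then τ* is the unique positive solution τ of the equation δ − 1/2 − (1/SNR)/τ² + G(1/τ) = 0. -/

import Mathlib

open Real

/-- The standard normal tail function `Q(x) = ∫_x^∞ (2π)^{-1/2} e^{-t²/2} dt`. -/
noncomputable def Qfun (x : ℝ) : ℝ :=
  ∫ t in Set.Ioi x, (Real.sqrt (2 * Real.pi))⁻¹ * Real.exp (-t ^ 2 / 2)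

/-- The function `F` from the paper, with parameters `δ` and `SNR`. -/
noncomputable def Ffun (δ SNR τ : ℝ) : ℝ :=
  τ * (δ - 1 / 2) + (1 / SNR) / τ + (τ + 4 / τ) * Qfun (2 / τ)
    - Real.sqrt (2 / Real.pi) * Real.exp (-2 / τ ^ 2)

/-- The function `G` from Lemma 4 of the paper. -/
noncomputable def Gfun (u : ℝ) : ℝ :=
  Real.sqrt (2 / Real.pi) * u * Real.exp (-2 * u ^ 2) + (1 - 4 * u ^ 2) * Qfun (2 * u)

lemma integrable_gaussian_density :
    MeasureTheory.Integrable
      (fun t : ℝ => (Real.sqrt (2 * Real.pi))⁻¹ * Real.exp (-t ^ 2 / 2)) := by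
  have h := (integrable_exp_neg_mul_sq (b := 1 / 2) (by norm_num)).const_mul
    (Real.sqrt (2 * Real.pi))⁻¹
  refine h.congr (Filter.Eventually.of_forall fun t => ?_)
  dsimp only
  ring_nf

lemma Qfun_nonneg (x : ℝ) : 0 ≤ Qfun x :=
  MeasureTheory.integral_nonneg fun t => by positivity

lemma hasDerivAt_Qfun (x : ℝ) :
    HasDerivAt Qfun (-((Real.sqrt (2 * Real.pi))⁻¹ * Real.exp (-x ^ 2 / 2))) x := by
  have hcont : Continuous
      (fun t : ℝ => (Real.sqrt (2 * Real.pi))⁻¹ * Real.exp (-t ^ 2 / 2)) := by fun_prop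
  have hQ : Qfun = fun y => Qfun 0 -
      ∫ t in (0 : ℝ)..y, (Real.sqrt (2 * Real.pi))⁻¹ * Real.exp (-t ^ 2 / 2) := by
    funext y
    exact eq_sub_of_add_eq' (intervalIntegral.integral_interval_add_Ioi
      integrable_gaussian_density.integrableOn integrable_gaussian_density.integrableOn)
  rw [hQ]
  exact (hcont.integral_hasStrictDerivAt 0 x).hasDerivAt.const_sub _

lemma sqrt_two_div_pi : Real.sqrt (2 / Real.pi) = 2 * (Real.sqrt (2 * Real.pi))⁻¹ := by
  have h : 2 / Real.pi = 2 ^ 2 / (2 * Real.pi) := by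
    field_simp
  rw [h, Real.sqrt_div (by positivity), Real.sqrt_sq (by norm_num), div_eq_mul_inv]

lemma hasDerivAt_Gfun (u : ℝ) : HasDerivAt Gfun (-8 * u * Qfun (2 * u)) u := by
  have hQ : HasDerivAt (fun v => Qfun (2 * v)) _ u :=
    (hasDerivAt_Qfun (2 * u)).comp u ((hasDerivAt_id u).const_mul 2)
  have hE : HasDerivAt (fun v : ℝ => Real.exp (-2 * v ^ 2)) _ u :=
    ((hasDerivAt_pow 2 u).const_mul (-2)).exp
  have h : HasDerivAt Gfun _ u :=
    (((hasDerivAt_id u).const_mul (Real.sqrt (2 / Real.pi))).mul hE).add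
      ((((hasDerivAt_pow 2 u).const_mul 4).const_sub 1).mul hQ)
  refine h.congr_deriv ?_
  have he : -(2 * u) ^ 2 / 2 = -2 * u ^ 2 := by ring
  simp only [id, sqrt_two_div_pi, he]
  push_cast
  ring

lemma hasDerivAt_Ffun (δ SNR : ℝ) {τ : ℝ} (hτ : 0 < τ) :
    HasDerivAt (Ffun δ SNR) (δ - 1 / 2 - (1 / SNR) / τ ^ 2 + Gfun (1 / τ)) τ := by
  have hτ0 : τ ≠ 0 := hτ.ne'
  have hdiv (c : ℝ) : HasDerivAt (fun t : ℝ => c / t) (-c / τ ^ 2) τ := by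
    refine ((hasDerivAt_inv hτ0).const_mul c).congr_deriv ?_
    field_simp
  have hQ : HasDerivAt (fun t => Qfun (2 / t)) _ τ :=
    (hasDerivAt_Qfun (2 / τ)).comp τ (hdiv 2)
  have hE : HasDerivAt (fun t : ℝ => Real.exp (-2 / t ^ 2))
      (Real.exp (-2 / τ ^ 2) * (4 / τ ^ 3)) τ := by
    refine HasDerivAt.exp ?_
    refine ((hasDerivAt_const τ (-2 : ℝ)).div (hasDerivAt_pow 2 τ) (by positivity)).congr_deriv ?_
    field_simp
    push_cast
    ring
  have h : HasDerivAt (Ffun δ SNR) _ τ :=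
    (((((hasDerivAt_id τ).mul_const (δ - 1 / 2)).add (hdiv (1 / SNR))).add
      (((hasDerivAt_id τ).add (hdiv 4)).mul hQ)).sub (hE.const_mul (Real.sqrt (2 / Real.pi))))
  refine h.congr_deriv ?_
  have he : -(2 / τ) ^ 2 / 2 = -2 / τ ^ 2 := by ring
  have he' : -2 * (1 / τ) ^ 2 = -2 / τ ^ 2 := by ring
  have hq : 2 * (1 / τ) = 2 / τ := by ring
  simp only [Gfun, Pi.add_apply, id, sqrt_two_div_pi, he, he', hq]
  field_simp
  ring

lemma strictAntiOn_sub_mul_sq_add_Gfun (c : ℝ) {a : ℝ} (ha : 0 < a) :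
    StrictAntiOn (fun u => c - a * u ^ 2 + Gfun u) (Set.Ioi 0) := by
  have hd (u : ℝ) : HasDerivAt (fun u => c - a * u ^ 2 + Gfun u)
      (-(a * (2 * u)) + -8 * u * Qfun (2 * u)) u := by
    refine ((((hasDerivAt_pow 2 u).const_mul a).const_sub c).add
      (hasDerivAt_Gfun u)).congr_deriv ?_
    norm_num
  refine strictAntiOn_of_deriv_neg (convex_Ioi 0)
    (fun u _ => (hd u).continuousAt.continuousWithinAt) fun u hu => ?_
  rw [interior_Ioi, Set.mem_Ioi] at hu
  rw [(hd u).deriv]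
  have h₁ : 0 < a * (2 * u) := by positivity
  have h₂ : 0 ≤ u * Qfun (2 * u) := mul_nonneg hu.le (Qfun_nonneg _)
  linarith

theorem stmt11 (δ SNR : ℝ) (hδ : 1 / 2 < δ) (hSNR : 0 < SNR)
    (τs : ℝ) (hτs : 0 < τs)
    (hmin : ∀ τ : ℝ, 0 < τ → Ffun δ SNR τs ≤ Ffun δ SNR τ) :
    (δ - 1 / 2 - (1 / SNR) / τs ^ 2 + Gfun (1 / τs) = 0) ∧
      ∀ τ : ℝ, 0 < τ → δ - 1 / 2 - (1 / SNR) / τ ^ 2 + Gfun (1 / τ) = 0 → τ = τs := by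
  have hcrit : δ - 1 / 2 - (1 / SNR) / τs ^ 2 + Gfun (1 / τs) = 0 := by
    have hloc : IsLocalMin (Ffun δ SNR) τs :=
      Filter.mem_of_superset (Ioi_mem_nhds hτs) hmin
    exact hloc.hasDerivAt_eq_zero (hasDerivAt_Ffun δ SNR hτs)
  refine ⟨hcrit, fun τ hτ h => ?_⟩
  have hsq (t : ℝ) : 1 / SNR / t ^ 2 = 1 / SNR * (1 / t) ^ 2 := by ring
  rw [hsq] at h hcrit
  have hinv : 1 / τ = 1 / τs :=
    (strictAntiOn_sub_mul_sq_add_Gfun (δ - 1 / 2) (one_div_pos.mpr hSNR)).injOn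
      (one_div_pos.mpr hτ) (one_div_pos.mpr hτs) (h.trans hcrit.symm)
  simpa using hinv
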